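/- Let (W, S) be a Coxeter system and (Q, φ) a maximal partial special matching on W (with respect to the Bruhat order) with a = φ(e) ∈ S. Then for every s ∈ S \ {a}, the principal dihedral subgroup P_s = ⟨s, a⟩ is contained in Q and is stable under φ. -/

import Mathlib

open CoxeterSystem Polynomial

section CoxPre

variable {B : Type*} {W : Type*} [Group W] {M : CoxeterMatrix B}

/-- The alternating word of length `n` starting with the letter `i`
(and then alternating between `i` and `j`). -/
def altW (i j : B) : ℕ → List B
  | 0 => []
  | n + 1 => i :: altW j i n

variable (cs : CoxeterSystem M W)

/-- The Bruhat order on a Coxeter group: the reflexive-transitive closure of the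
relation `u → u * t` (`t` a reflection) when the length goes up. -/
def bruhatLE : W → W → Prop :=
  Relation.ReflTransGen
    (fun u v => ∃ t, cs.IsReflection t ∧ v = u * t ∧ cs.length u < cs.length v)

/-- The covering relation of the Bruhat order. -/
def bCov (u v : W) : Prop :=
  bruhatLE cs u v ∧ u ≠ v ∧ ∀ z, bruhatLE cs u z → bruhatLE cs z v → z = u ∨ z = v

/-- The set of coatoms of `v` in the Bruhat order. -/
def bCoat (v : W) : Set W := {x | bCov cs x v}

/-- A partial special matching of `W` equipped with the Bruhat order: a Bruhat order
ideal `dom` together with an involution of it such that `u ⋖ φ u` or `φ u ⋖ u` for all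
`u ∈ dom`, satisfying the coatom condition. -/
structure BSM where
  dom : Set W
  toFun : W → W
  ideal : ∀ ⦃x y : W⦄, y ∈ dom → bruhatLE cs x y → x ∈ dom
  maps : ∀ x ∈ dom, toFun x ∈ dom
  invol : ∀ x ∈ dom, toFun (toFun x) = x
  cov : ∀ x ∈ dom, bCov cs (toFun x) x ∨ bCov cs x (toFun x)
  coatom : ∀ u ∈ dom, bCov cs u (toFun u) →
    bCoat cs (toFun u) =
      {u} ∪ {w | ∃ v, bCov cs v u ∧ bCov cs v (toFun v) ∧ w = toFun v}

/-- The standard dihedral subgroup `⟨s,t⟩` of `W`, as a set. -/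
def dihedral (s t : B) : Set W :=
  (Subgroup.closure {cs.simple s, cs.simple t} : Subgroup W)

/-- `w` is full with respect to `J ⊆ S`: for all distinct `i, j ∈ J`, `m i j < ∞` and the
longest element of `⟨i,j⟩` is `≤ w` in Bruhat order. -/
def IsFullWrt (J : Set B) (w : W) : Prop :=
  ∀ i ∈ J, ∀ j ∈ J, i ≠ j →
    M i j ≠ 0 ∧ bruhatLE cs (cs.wordProd (altW i j (M i j))) w

/-- The standard axioms characterizing the `R`-polynomials of the Hecke algebra of `W`. -/
def RAxioms (R : W → W → Polynomial ℤ) : Prop :=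
  (∀ u, R u u = 1) ∧
  (∀ u v, ¬ bruhatLE cs u v → R u v = 0) ∧
  (∀ (i : B) (x y : W),
      cs.length (cs.simple i * x) = cs.length x + 1 →
      cs.length (cs.simple i * y) = cs.length y + 1 →
      R (cs.simple i * x) (cs.simple i * y) = R x y ∧
      R x (cs.simple i * y) = (X - 1) * R x y + X * R (cs.simple i * x) y) ∧
  (∀ (i : B) (x y : W),
      cs.length (x * cs.simple i) = cs.length x + 1 →
      cs.length (y * cs.simple i) = cs.length y + 1 →
      R (x * cs.simple i) (y * cs.simple i) = R x y ∧
      R x (y * cs.simple i) = (X - 1) * R x y + X * R (x * cs.simple i) y)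

variable {cs}

/-- `ψ` extends the partial special matching `φ`. -/
def BExtends (ψ φ : BSM cs) : Prop :=
  φ.dom ⊆ ψ.dom ∧ ∀ x ∈ φ.dom, ψ.toFun x = φ.toFun x

/-- `φ` is a maximal partial special matching. -/
def BMax (φ : BSM cs) : Prop := ∀ ψ : BSM cs, BExtends ψ φ → ψ.dom = φ.dom

/-- `φ` is `g`-regular on the left: its domain is stable under left multiplication by `g`
and `φ` commutes with left multiplication by `g`. -/
def LeftReg (φ : BSM cs) (g : W) : Prop :=
  (∀ x ∈ φ.dom, g * x ∈ φ.dom) ∧ ∀ x ∈ φ.dom, φ.toFun (g * x) = g * φ.toFun x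

/-- `φ` is `g`-regular on the right. -/
def RightReg (φ : BSM cs) (g : W) : Prop :=
  (∀ x ∈ φ.dom, x * g ∈ φ.dom) ∧ ∀ x ∈ φ.dom, φ.toFun (x * g) = φ.toFun x * g

end CoxPre
section ReflectionCocycle

variable {B : Type*} {W : Type*} [Group W] {M : CoxeterMatrix B} (cs : CoxeterSystem M W)

open Classical in
/-- The action of a simple reflection `s i` on pairs `(t, ε)`: conjugate `t`, and flip the sign `ε`
if `t = s i`. -/
noncomputable def reflectionStep (i : B) : Function.End (W × ZMod 2) := fun p =>
  (cs.simple i * p.1 * cs.simple i, p.2 + if p.1 = cs.simple i then 1 else 0)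

lemma simple_mul_pow_eq_inv_pow_mul (i j : B) (n : ℕ) :
    cs.simple j * (cs.simple i * cs.simple j) ^ n =
      ((cs.simple i * cs.simple j) ^ n)⁻¹ * cs.simple j := by
  rw [← inv_pow, mul_inv_rev, cs.inv_simple, cs.inv_simple]
  induction n with
  | zero => simp
  | succ n ih => rw [pow_succ, ← mul_assoc, ih, pow_succ]; simp only [mul_assoc]

lemma conj_pow_eq_simple_iff (i j : B) (n : ℕ) (t : W) :
    (cs.simple i * cs.simple j) ^ n * t * ((cs.simple i * cs.simple j) ^ n)⁻¹ = cs.simple j ↔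
      t = cs.simple j * (cs.simple i * cs.simple j) ^ (2 * n) := by
  rw [two_mul, pow_add, ← mul_assoc (cs.simple j), simple_mul_pow_eq_inv_pow_mul,
    mul_inv_eq_iff_eq_mul, mul_assoc, eq_inv_mul_iff_mul_eq]

lemma conj_simple_pow_eq_simple_iff (i j : B) (n : ℕ) (t : W) :
    cs.simple j * ((cs.simple i * cs.simple j) ^ n * t * ((cs.simple i * cs.simple j) ^ n)⁻¹) *
        cs.simple j = cs.simple i ↔
      t = cs.simple j * (cs.simple i * cs.simple j) ^ (2 * n + 1) := by
  have h : cs.simple j * (cs.simple i * cs.simple j) ^ (2 * n + 1) =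
      ((cs.simple i * cs.simple j) ^ n)⁻¹ * (cs.simple j * cs.simple i * cs.simple j) *
        (cs.simple i * cs.simple j) ^ n := by
    rw [show 2 * n + 1 = n + (1 + n) by omega, pow_add, pow_add, ← mul_assoc,
      simple_mul_pow_eq_inv_pow_mul]
    simp [mul_assoc]
  rw [h]
  generalize (cs.simple i * cs.simple j) ^ n = g
  constructor
  · intro h
    rw [← h]
    simp [mul_assoc]
  · rintro rfl
    simp [mul_assoc]

open Classical in
lemma reflectionStep_pow_apply (i j : B) (n : ℕ) (t : W) (ε : ZMod 2) :
    ((reflectionStep cs i * reflectionStep cs j) ^ n) (t, ε) =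
      ((cs.simple i * cs.simple j) ^ n * t * ((cs.simple i * cs.simple j) ^ n)⁻¹,
        ε + ∑ r ∈ Finset.range (2 * n),
          if t = cs.simple j * (cs.simple i * cs.simple j) ^ r then 1 else 0) := by
  induction n with
  | zero => simp; rfl
  | succ n ih =>
    have hstep : ((reflectionStep cs i * reflectionStep cs j) ^ (n + 1)) (t, ε) =
        reflectionStep cs i (reflectionStep cs j
          (((reflectionStep cs i * reflectionStep cs j) ^ n) (t, ε))) := by
      rw [pow_succ']; rfl
    rw [hstep, ih, show 2 * (n + 1) = 2 * n + 1 + 1 by ring, Finset.sum_range_succ,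
      Finset.sum_range_succ]
    simp only [reflectionStep, conj_pow_eq_simple_iff, conj_simple_pow_eq_simple_iff]
    refine Prod.ext ?_ (by simp only [add_assoc])
    simp [pow_succ', mul_assoc]

lemma isLiftable_reflectionStep : M.IsLiftable (reflectionStep cs) := by
  classical
  intro i j
  funext ⟨t, ε⟩
  rw [reflectionStep_pow_apply, two_mul, Finset.sum_range_add]
  simp only [pow_add, cs.simple_mul_simple_pow, one_mul, inv_one, mul_one, CharTwo.add_self_eq_zero,
    add_zero]
  rfl

/-- The action of `W` on pairs `(t, ε)` extending `reflectionStep`. -/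
noncomputable def reflectionAction : W →* Function.End (W × ZMod 2) :=
  cs.lift ⟨reflectionStep cs, isLiftable_reflectionStep cs⟩

open Classical in
lemma reflectionAction_simple (i : B) (t : W) (ε : ZMod 2) :
    reflectionAction cs (cs.simple i) (t, ε) =
      (cs.simple i * t * cs.simple i, ε + if t = cs.simple i then 1 else 0) := by
  rw [reflectionAction, cs.lift_apply_simple]; rfl

lemma reflectionAction_mul (u v : W) (p : W × ZMod 2) :
    reflectionAction cs (u * v) p = reflectionAction cs u (reflectionAction cs v p) := by
  rw [map_mul]; rfl

open Classical in
lemma reflectionAction_wordProd (ω : List B) (t : W) (ε : ZMod 2) :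
    reflectionAction cs (cs.wordProd ω) (t, ε) =
      (cs.wordProd ω * t * (cs.wordProd ω)⁻¹, ε + ((cs.rightInvSeq ω).count t : ℕ)) := by
  induction ω with
  | nil => simp; rfl
  | cons i ω ih =>
    rw [cs.wordProd_cons, reflectionAction_mul, ih, reflectionAction_simple]
    refine Prod.ext (by simp [mul_assoc]) ?_
    have : cs.wordProd ω * t * (cs.wordProd ω)⁻¹ = cs.simple i ↔
        (cs.wordProd ω)⁻¹ * cs.simple i * cs.wordProd ω = t := by
      rw [mul_inv_eq_iff_eq_mul, mul_assoc, inv_mul_eq_iff_eq_mul, eq_comm]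
    simp only [CoxeterSystem.rightInvSeq, List.count_cons, this, beq_iff_eq]
    push_cast
    rw [add_assoc]

lemma reflectionAction_fst (w t : W) (ε : ZMod 2) :
    (reflectionAction cs w (t, ε)).1 = w * t * w⁻¹ := by
  classical
  obtain ⟨ω, rfl⟩ := cs.wordProd_surjective w
  rw [reflectionAction_wordProd]

lemma reflectionAction_snd (w t : W) (ε : ZMod 2) :
    (reflectionAction cs w (t, ε)).2 = ε + (reflectionAction cs w (t, 0)).2 := by
  classical
  obtain ⟨ω, rfl⟩ := cs.wordProd_surjective w
  simp [reflectionAction_wordProd]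

lemma reflectionAction_add_one (w t : W) (ε : ZMod 2) :
    reflectionAction cs w (t, ε + 1) =
      ((reflectionAction cs w (t, ε)).1, (reflectionAction cs w (t, ε)).2 + 1) := by
  refine Prod.ext (by simp only [reflectionAction_fst]) ?_
  rw [reflectionAction_snd, reflectionAction_snd cs w t ε]
  ring

lemma reflectionAction_self {t : W} (ht : cs.IsReflection t) :
    reflectionAction cs t (t, 0) = (t, 1) := by
  obtain ⟨u, i, rfl⟩ := ht
  set t := u * cs.simple i * u⁻¹ with ht
  have h1 : reflectionAction cs u⁻¹ (t, 0) =
      (cs.simple i, (reflectionAction cs u⁻¹ (t, 0)).2) :=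
    Prod.ext (by rw [reflectionAction_fst, ht]; group) rfl
  have h2 : reflectionAction cs u (reflectionAction cs u⁻¹ (t, 0)) = (t, 0) := by
    rw [← reflectionAction_mul, mul_inv_cancel, map_one]; rfl
  rw [h1] at h2
  conv_lhs => rw [ht]
  rw [reflectionAction_mul, reflectionAction_mul, h1, reflectionAction_simple]
  simp only [if_true, cs.simple_mul_simple_cancel_right]
  rw [reflectionAction_add_one, h2]
  simp

/-- The strong exchange property: every right inversion of the product of a word occurs in the
right inversion sequence of this word. -/
theorem mem_rightInvSeq_of_isRightInversion {ω : List B} {t : W}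
    (h : cs.IsRightInversion (cs.wordProd ω) t) : t ∈ cs.rightInvSeq ω := by
  classical
  by_contra hmem
  obtain ⟨ht, hlt⟩ := h
  obtain ⟨ω', hω', hw⟩ := cs.exists_isReduced (cs.wordProd ω * t)
  have hval : (reflectionAction cs (cs.wordProd ω * t) (t, 0)).2 = 1 := by
    rw [reflectionAction_mul, reflectionAction_self cs ht, reflectionAction_wordProd,
      List.count_eq_zero_of_not_mem hmem]
    simp
  have hmem' : t ∈ cs.rightInvSeq ω' := by
    by_contra hn
    rw [hw, reflectionAction_wordProd, List.count_eq_zero_of_not_mem hn] at hval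
    simp at hval
  have := (cs.isRightInversion_of_mem_rightInvSeq hω' hmem').2
  rw [← hw, mul_assoc, ht.mul_self, mul_one] at this
  exact lt_asymm hlt this

/-- Multiplying the product of a word by a right inversion deletes a letter of this word. -/
theorem exists_eraseIdx_of_isRightInversion {ω : List B} {t : W}
    (h : cs.IsRightInversion (cs.wordProd ω) t) :
    ∃ j < ω.length, cs.wordProd ω * t = cs.wordProd (ω.eraseIdx j) := by
  obtain ⟨j, hj, rfl⟩ := List.mem_iff_getElem.1 (mem_rightInvSeq_of_isRightInversion cs h)
  refine ⟨j, by simpa using hj, ?_⟩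
  rw [← cs.wordProd_mul_getD_rightInvSeq, List.getD_eq_getElem _ _ hj]

end ReflectionCocycle

section Parabolic

variable {B : Type*} {W : Type*} [Group W] {M : CoxeterMatrix B} (cs : CoxeterSystem M W)

lemma wordProd_mem_closure {J : Set B} {ω : List B} (h : ∀ i ∈ ω, i ∈ J) :
    cs.wordProd ω ∈ Subgroup.closure (cs.simple '' J) := by
  induction ω with
  | nil => simp
  | cons i ω ih =>
    rw [cs.wordProd_cons]
    exact mul_mem (Subgroup.subset_closure ⟨i, h i (by simp), rfl⟩)
      (ih fun k hk => h k (by simp [hk]))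

/-- Every element of a standard parabolic subgroup `W_J` has a reduced word with letters
in `J`. -/
theorem exists_isReduced_of_mem_closure {J : Set B} {w : W}
    (hw : w ∈ Subgroup.closure (cs.simple '' J)) :
    ∃ ω : List B, (∀ i ∈ ω, i ∈ J) ∧ cs.IsReduced ω ∧ w = cs.wordProd ω := by
  have step : ∀ x, ∀ y ∈ cs.simple '' J,
      (∃ ω : List B, (∀ i ∈ ω, i ∈ J) ∧ cs.IsReduced ω ∧ x = cs.wordProd ω) →
      ∃ ω : List B, (∀ i ∈ ω, i ∈ J) ∧ cs.IsReduced ω ∧ x * y = cs.wordProd ω := by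
    rintro _ _ ⟨i, hi, rfl⟩ ⟨ω, hωJ, hω, rfl⟩
    rcases cs.length_mul_simple (cs.wordProd ω) i with h | h
    · refine ⟨ω ++ [i], ?_, ?_, by simp [cs.wordProd_append]⟩
      · simp only [List.mem_append, List.mem_singleton]
        rintro k (hk | rfl)
        exacts [hωJ k hk, hi]
      · simp [CoxeterSystem.IsReduced, cs.wordProd_append, h, hω.eq]
    · obtain ⟨j, hj, he⟩ := exists_eraseIdx_of_isRightInversion cs
        (ω := ω) (t := cs.simple i) ⟨cs.isReflection_simple i, by omega⟩
      refine ⟨ω.eraseIdx j, fun k hk => hωJ k (List.mem_of_mem_eraseIdx hk), ?_, he⟩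
      rw [CoxeterSystem.IsReduced, ← he, List.length_eraseIdx_of_lt hj, ← hω.eq]
      omega
  induction hw using Subgroup.closure_induction_right with
  | one => exact ⟨[], by simp, by simp [CoxeterSystem.IsReduced], by simp⟩
  | mul_right x hx y hy ih => exact step x y hy ih
  | mul_inv_cancel x hx y hy ih =>
    obtain ⟨i, hi, rfl⟩ := hy
    rw [cs.inv_simple]
    exact step x _ ⟨i, hi, rfl⟩ ih

lemma bruhatLE.eq_or_length_lt {cs : CoxeterSystem M W} {u v : W} (h : bruhatLE cs u v) :
    u = v ∨ cs.length u < cs.length v := by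
  induction h with
  | refl => exact Or.inl rfl
  | tail _ h ih =>
    obtain ⟨t, -, -, hlt⟩ := h
    rcases ih with rfl | ih
    exacts [Or.inr hlt, Or.inr (ih.trans hlt)]

lemma bCov.length_lt {cs : CoxeterSystem M W} {u v : W} (h : bCov cs u v) :
    cs.length u < cs.length v :=
  h.1.eq_or_length_lt.resolve_left h.2.1

lemma bCov_of_length_eq {cs : CoxeterSystem M W} {u v : W} (h : bruhatLE cs u v)
    (hl : cs.length v = cs.length u + 1) : bCov cs u v := by
  refine ⟨h, by rintro rfl; omega, fun z h1 h2 => ?_⟩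
  rcases h1.eq_or_length_lt with rfl | h1
  · exact Or.inl rfl
  rcases h2.eq_or_length_lt with rfl | h2
  · exact Or.inr rfl
  omega

lemma bruhatLE_mul_simple {w : W} {i : B} (h : cs.length w < cs.length (w * cs.simple i)) :
    bruhatLE cs w (w * cs.simple i) :=
  .single ⟨_, cs.isReflection_simple i, rfl, h⟩

lemma bruhatLE_simple_mul {w : W} {i : B} (h : cs.length w < cs.length (cs.simple i * w)) :
    bruhatLE cs w (cs.simple i * w) :=
  .single ⟨w⁻¹ * cs.simple i * w, ⟨w⁻¹, i, by simp⟩, by group, h⟩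

/-- Standard parabolic subgroups are Bruhat order ideals. -/
lemma mem_closure_of_bruhatLE {J : Set B} {u v : W}
    (hv : v ∈ Subgroup.closure (cs.simple '' J)) (h : bruhatLE cs u v) :
    u ∈ Subgroup.closure (cs.simple '' J) := by
  induction h using Relation.ReflTransGen.head_induction_on with
  | refl => exact hv
  | head h _ ih =>
    obtain ⟨t, ht, rfl, hlt⟩ := h
    obtain ⟨ω, hωJ, -, he⟩ := exists_isReduced_of_mem_closure cs ih
    obtain ⟨j, -, hj⟩ := exists_eraseIdx_of_isRightInversion cs (ω := ω) (t := t)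
      ⟨ht, by rwa [← he, mul_assoc, ht.mul_self, mul_one]⟩
    rw [← he, mul_assoc, ht.mul_self, mul_one] at hj
    rw [hj]
    exact wordProd_mem_closure cs fun k hk => hωJ k (List.mem_of_mem_eraseIdx hk)

/-- An element of length at least two all of whose coatoms lie in a standard parabolic subgroup
lies in it as well. -/
lemma mem_closure_of_bCoat_subset {J : Set B} {x : W} (hx : 2 ≤ cs.length x)
    (h : bCoat cs x ⊆ Subgroup.closure (cs.simple '' J)) :
    x ∈ Subgroup.closure (cs.simple '' J) := by
  obtain ⟨ω, hω, rfl⟩ := cs.exists_isReduced x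
  rw [hω.eq] at hx
  obtain _ | ⟨i, ω⟩ := ω
  · simp at hx
  obtain rfl | ⟨μ, k, rfl⟩ := List.eq_nil_or_concat' ω
  · simp at hx
  have hl := hω.eq
  have htail : cs.length (cs.wordProd (μ ++ [k])) = (μ ++ [k]).length := hω.drop 1
  have hinit : cs.length (cs.wordProd (i :: μ)) = (i :: μ).length := by
    simpa [CoxeterSystem.IsReduced] using hω.take (μ.length + 1)
  have hmid : cs.length (cs.wordProd μ) = μ.length := by
    simpa [CoxeterSystem.IsReduced] using (hω.drop 1).take μ.length
  simp only [List.length_cons, List.length_append, List.length_nil] at hl htail hinit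
  have h1 : cs.wordProd (μ ++ [k]) ∈ Subgroup.closure (cs.simple '' J) := by
    refine h (bCov_of_length_eq ?_ (by omega))
    rw [cs.wordProd_cons] at hl ⊢
    exact bruhatLE_simple_mul cs (by omega)
  have h2 : cs.wordProd (i :: μ) ∈ Subgroup.closure (cs.simple '' J) := by
    refine h (bCov_of_length_eq ?_ (by omega))
    rw [← List.cons_append, cs.wordProd_append, cs.wordProd_singleton] at hl ⊢
    exact bruhatLE_mul_simple cs (by omega)
  have h3 : cs.wordProd μ ∈ Subgroup.closure (cs.simple '' J) := by
    refine mem_closure_of_bruhatLE cs h2 ?_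
    rw [cs.wordProd_cons] at hinit ⊢
    exact bruhatLE_simple_mul cs (by omega)
  have h4 : cs.simple i ∈ Subgroup.closure (cs.simple '' J) := by
    rw [cs.wordProd_cons] at h2
    exact (Subgroup.mul_mem_cancel_right _ h3).1 h2
  rw [cs.wordProd_cons]
  exact mul_mem h4 h1

end Parabolic

section Dihedral

variable {B : Type*} {W : Type*} [Group W] {M : CoxeterMatrix B} (cs : CoxeterSystem M W)

lemma dihedral_eq (i j : B) :
    dihedral cs i j = (Subgroup.closure (cs.simple '' {i, j}) : Subgroup W) := by
  rw [Set.image_pair]; rfl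

lemma dihedral_comm (i j : B) : dihedral cs i j = dihedral cs j i := by
  rw [dihedral_eq, dihedral_eq, Set.pair_comm]

lemma mem_dihedral_of_bruhatLE {i j : B} {u v : W} (hv : v ∈ dihedral cs i j)
    (h : bruhatLE cs u v) : u ∈ dihedral cs i j := by
  rw [dihedral_eq] at *
  exact mem_closure_of_bruhatLE cs hv h

lemma length_altW (i j : B) (n : ℕ) : (altW i j n).length = n := by
  induction n generalizing i j with
  | zero => rfl
  | succ n ih => simp [altW, ih]

lemma take_altW (i j : B) (n : ℕ) : (altW i j (n + 1)).take n = altW i j n := by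
  induction n generalizing i j with
  | zero => rfl
  | succ n ih => rw [altW, List.take_succ_cons, ih, altW]

lemma wordProd_altW_succ (i j : B) (n : ℕ) :
    cs.wordProd (altW i j (n + 1)) = cs.simple i * cs.wordProd (altW j i n) :=
  cs.wordProd_cons _ _

lemma wordProd_altW_mem_dihedral (i j : B) (n : ℕ) :
    cs.wordProd (altW i j n) ∈ dihedral cs i j := by
  induction n generalizing i j with
  | zero => exact one_mem _
  | succ n ih =>
    have h := ih j i
    rw [dihedral_comm] at h
    rw [wordProd_altW_succ]
    exact mul_mem (Subgroup.subset_closure (by simp)) h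

lemma length_wordProd_altW_le (i j : B) (n : ℕ) : cs.length (cs.wordProd (altW i j n)) ≤ n := by
  simpa [length_altW] using cs.length_wordProd_le (altW i j n)

lemma isReduced_altW_iff {i j : B} {n : ℕ} :
    cs.IsReduced (altW i j n) ↔ cs.length (cs.wordProd (altW i j n)) = n := by
  rw [CoxeterSystem.IsReduced, length_altW]

lemma isReduced_altW_of_succ {i j : B} {n : ℕ} (h : cs.IsReduced (altW i j (n + 1))) :
    cs.IsReduced (altW i j n) := by
  simpa [take_altW] using h.take n

lemma isReduced_altW_swap_of_succ {i j : B} {n : ℕ} (h : cs.IsReduced (altW i j (n + 1))) :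
    cs.IsReduced (altW j i n) :=
  h.drop 1

lemma isReduced_altW_of_le {i j : B} {m n : ℕ} (hmn : m ≤ n) (h : cs.IsReduced (altW i j n)) :
    cs.IsReduced (altW i j m) := by
  induction n, hmn using Nat.le_induction with
  | base => exact h
  | succ n _ ih => exact ih (isReduced_altW_of_succ cs h)

/-- A reduced word in two letters is alternating. -/
lemma IsReduced.eq_altW {i j : B} {ω : List B} (hω : cs.IsReduced ω)
    (h : ∀ k ∈ ω, k = i ∨ k = j) : ω = altW i j ω.length ∨ ω = altW j i ω.length := by
  induction ω with
  | nil => exact Or.inl rfl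
  | cons k ω ih =>
    have hne : ∀ (k l : B) (n : ℕ), cs.IsReduced (k :: altW k l (n + 1)) → False := by
      intro k l n hr
      have h1 := hr.eq
      rw [altW, cs.wordProd_cons, cs.wordProd_cons, cs.simple_mul_simple_cancel_left] at h1
      have h2 := length_wordProd_altW_le cs l k n
      simp only [List.length_cons, length_altW] at h1
      omega
    have hω' := ih (hω.drop 1) fun l hl => h l (by simp [hl])
    rcases eq_or_ne ω [] with rfl | hne0
    · simpa [altW] using h k (by simp)
    · obtain ⟨n, hn⟩ := Nat.exists_eq_succ_of_ne_zero fun h0 =>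
        hne0 (List.length_eq_zero_iff.1 h0)
      rw [hn] at hω'
      rw [List.length_cons, hn]
      rcases h k (by simp) with rfl | rfl <;> rcases hω' with he | he
      · exact (hne _ _ _ (he ▸ hω)).elim
      · exact Or.inl (by rw [altW, ← he])
      · exact Or.inr (by rw [altW, ← he])
      · exact (hne _ _ _ (he ▸ hω)).elim

lemma eq_wordProd_altW_of_mem_dihedral {i j : B} {w : W} (hw : w ∈ dihedral cs i j) :
    w = cs.wordProd (altW i j (cs.length w)) ∨ w = cs.wordProd (altW j i (cs.length w)) := by
  rw [dihedral_eq] at hw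
  obtain ⟨ω, hωJ, hω, rfl⟩ := exists_isReduced_of_mem_closure cs hw
  rw [hω.eq]
  exact (IsReduced.eq_altW cs hω hωJ).imp (congrArg _) (congrArg _)

lemma eq_or_eq_of_length_eq {i j : B} {u v w : W} (hu : u ∈ dihedral cs i j)
    (hv : v ∈ dihedral cs i j) (hw : w ∈ dihedral cs i j) (hvl : cs.length v = cs.length u)
    (hwl : cs.length w = cs.length u) (huv : u ≠ v) : w = u ∨ w = v := by
  have h1 := eq_wordProd_altW_of_mem_dihedral cs hu
  have h2 := eq_wordProd_altW_of_mem_dihedral cs hv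
  have h3 := eq_wordProd_altW_of_mem_dihedral cs hw
  rw [hvl] at h2
  rw [hwl] at h3
  grind

/-- Below the length of an element of a dihedral subgroup `⟨i, j⟩`, both alternating words are
reduced, and their products differ. -/
lemma altW_of_lt_length {i j : B} {w : W} (hw : w ∈ dihedral cs i j) {n : ℕ}
    (hn : n < cs.length w) :
    cs.IsReduced (altW i j n) ∧ cs.IsReduced (altW j i n) ∧
      (n ≠ 0 → cs.wordProd (altW i j n) ≠ cs.wordProd (altW j i n)) := by
  wlog hw' : w = cs.wordProd (altW i j (cs.length w)) generalizing i j
  · obtain ⟨h1, h2, h3⟩ := this (dihedral_comm cs i j ▸ hw)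
      ((eq_wordProd_altW_of_mem_dihedral cs hw).resolve_left hw')
    exact ⟨h2, h1, fun h => (h3 h).symm⟩
  have hr : cs.IsReduced (altW i j (n + 1)) :=
    isReduced_altW_of_le cs hn (by rw [isReduced_altW_iff, ← hw'])
  refine ⟨isReduced_altW_of_succ cs hr, isReduced_altW_swap_of_succ cs hr, fun h0 he => ?_⟩
  obtain ⟨n, rfl⟩ := Nat.exists_eq_succ_of_ne_zero h0
  rw [isReduced_altW_iff, wordProd_altW_succ, ← he, wordProd_altW_succ,
    cs.simple_mul_simple_cancel_left] at hr
  have := length_wordProd_altW_le cs j i n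
  omega

lemma exists_ne_of_lt_length {i j : B} {w : W} (hw : w ∈ dihedral cs i j) {n : ℕ}
    (hn0 : n ≠ 0) (hn : n < cs.length w) :
    ∃ u ∈ dihedral cs i j, ∃ v ∈ dihedral cs i j,
      cs.length u = n ∧ cs.length v = n ∧ u ≠ v := by
  obtain ⟨h1, h2, h3⟩ := altW_of_lt_length cs hw hn
  rw [isReduced_altW_iff] at h1 h2
  exact ⟨_, wordProd_altW_mem_dihedral cs i j n, _,
    dihedral_comm cs i j ▸ wordProd_altW_mem_dihedral cs j i n, h1, h2, h3 hn0⟩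

/-- Two distinct elements of the same length in a dihedral subgroup are not maximal in it. -/
lemma exists_length_eq_succ {i j : B} {u v : W} (hu : u ∈ dihedral cs i j)
    (hv : v ∈ dihedral cs i j) (hl : cs.length v = cs.length u) (huv : u ≠ v) :
    ∃ w ∈ dihedral cs i j, cs.length w = cs.length u + 1 := by
  wlog hu' : u = cs.wordProd (altW i j (cs.length u)) generalizing i j
  · rw [dihedral_comm] at hu hv ⊢
    exact this hu hv ((eq_wordProd_altW_of_mem_dihedral cs hu).resolve_right hu')
  have hv' : v = cs.wordProd (altW j i (cs.length u)) := by
    rcases eq_wordProd_altW_of_mem_dihedral cs hv with h | h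
    · rw [hl, ← hu'] at h
      exact (huv h.symm).elim
    · rwa [hl] at h
  have hmem : cs.simple i * v ∈ dihedral cs i j := mul_mem (Subgroup.subset_closure (by simp)) hv
  refine ⟨_, hmem, ?_⟩
  rcases cs.length_simple_mul v i with h | h
  · rw [h, hl]
  exfalso
  obtain ⟨n, hn⟩ : ∃ n, cs.length u = n + 1 := ⟨cs.length (cs.simple i * v), by omega⟩
  have hln : cs.length (cs.simple i * v) = n := by omega
  rw [hn] at hu' hv' hl
  have key := eq_wordProd_altW_of_mem_dihedral cs hmem
  rw [hln] at key
  rcases key with h' | h'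
  · obtain _ | n := n
    · rw [mul_eq_one_iff_eq_inv'.1 h', cs.inv_simple] at huv
      exact huv (by rw [hu']; simp [altW])
    · rw [wordProd_altW_succ, mul_right_inj] at h'
      have := length_wordProd_altW_le cs j i n
      rw [← h'] at this
      omega
  · apply huv
    rw [hu', wordProd_altW_succ, ← h', cs.simple_mul_simple_cancel_left]

lemma bCov_of_mem_dihedral {i j : B} {u v : W} (hu : u ∈ dihedral cs i j)
    (hv : v ∈ dihedral cs i j) (hl : cs.length v = cs.length u + 1) : bCov cs u v := by
  refine bCov_of_length_eq ?_ hl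
  wlog hv' : v = cs.wordProd (altW i j (cs.length u + 1)) generalizing i j
  · rw [dihedral_comm] at hu hv
    exact this hu hv (hl ▸ (eq_wordProd_altW_of_mem_dihedral cs hv).resolve_right (hl ▸ hv'))
  rcases eq_wordProd_altW_of_mem_dihedral cs hu with hu' | hu'
  · have hsplit := List.take_append_drop (cs.length u) (altW i j (cs.length u + 1))
    have hlast : ((altW i j (cs.length u + 1)).drop (cs.length u)).length = 1 := by
      simp [length_altW]
    obtain ⟨k, hk⟩ := List.length_eq_one_iff.1 hlast
    rw [take_altW, hk] at hsplit
    rw [← hsplit, cs.wordProd_append, cs.wordProd_singleton, ← hu'] at hv'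
    subst hv'
    exact bruhatLE_mul_simple cs (by omega)
  · rw [wordProd_altW_succ, ← hu'] at hv'
    subst hv'
    exact bruhatLE_simple_mul cs (by omega)

lemma bruhatLE_of_mem_dihedral {i j : B} {u v : W} (hu : u ∈ dihedral cs i j)
    (hv : v ∈ dihedral cs i j) (hl : cs.length u < cs.length v) : bruhatLE cs u v := by
  induction h : cs.length v - cs.length u - 1 generalizing u with
  | zero => exact (bCov_of_mem_dihedral cs hu hv (by omega)).1
  | succ n ih =>
    obtain ⟨z, hz, -, -, hzl, -⟩ :=
      exists_ne_of_lt_length cs hv (n := cs.length u + 1) (by omega) (by omega)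
    exact (bCov_of_mem_dihedral cs hu hz hzl).1.trans (ih hz (by omega) (by omega))

lemma bCov.length_eq_of_mem_dihedral {cs : CoxeterSystem M W} {i j : B} {u v : W}
    (h : bCov cs u v) (hv : v ∈ dihedral cs i j) : cs.length v = cs.length u + 1 := by
  have hu := mem_dihedral_of_bruhatLE cs hv h.1
  by_contra hne
  have hlt := h.length_lt
  obtain ⟨z, hz, -, -, hzl, -⟩ :=
    exists_ne_of_lt_length cs hv (n := cs.length u + 1) (by omega) (by omega)
  rcases h.2.2 z (bruhatLE_of_mem_dihedral cs hu hz (by omega))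
    (bruhatLE_of_mem_dihedral cs hz hv (by omega)) with rfl | rfl <;> omega

end Dihedral

section Matching

variable {B : Type*} {W : Type*} [Group W] {M : CoxeterMatrix B} {cs : CoxeterSystem M W}
  (φ : BSM cs)

/-- A partial special matching sending `1` into a dihedral subgroup stabilizes it. -/
lemma BSM.map_mem_dihedral {i j : B} (h1 : φ.toFun 1 ∈ dihedral cs i j) {w : W}
    (hw : w ∈ dihedral cs i j) (hwQ : w ∈ φ.dom) : φ.toFun w ∈ dihedral cs i j := by
  induction hn : cs.length w using Nat.strong_induction_on generalizing w with
  | _ n ih =>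
    subst hn
    rcases eq_or_ne w 1 with rfl | hw1
    · exact h1
    rcases φ.cov w hwQ with h | h
    · exact mem_dihedral_of_bruhatLE cs hw h.1
    have hl0 : cs.length w ≠ 0 := fun h0 => hw1 (cs.length_eq_zero_iff.1 h0)
    have hlt := h.length_lt
    rw [dihedral_eq]
    refine mem_closure_of_bCoat_subset cs (by omega) ?_
    rw [φ.coatom w hwQ h, ← dihedral_eq]
    rintro x (rfl | ⟨v, hv, -, rfl⟩)
    · exact hw
    · exact ih _ hv.length_lt (mem_dihedral_of_bruhatLE cs hw hv.1) (φ.ideal hwQ hv.1) rfl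

/-- As long as all the shorter elements of a dihedral subgroup lie in the domain, exactly one
element of each length is matched upwards. -/
lemma BSM.exists_unique_matched_up {i j : B} (h1 : (1 : W) ∈ φ.dom)
    (ha : φ.toFun 1 ∈ dihedral cs i j) {x : W} (hx : x ∈ dihedral cs i j)
    (hQ : ∀ w ∈ dihedral cs i j, cs.length w < cs.length x → w ∈ φ.dom) {n : ℕ}
    (hn : n < cs.length x) :
    ∃ p ∈ dihedral cs i j, cs.length p = n ∧ bCov cs p (φ.toFun p) ∧
      ∀ q ∈ dihedral cs i j, cs.length q = n → q ≠ p → bCov cs (φ.toFun q) q := by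
  induction n with
  | zero =>
    refine ⟨1, one_mem _, by simp, ?_, fun q _ hq h => (h (cs.length_eq_zero_iff.1 hq)).elim⟩
    exact (φ.cov 1 h1).resolve_left fun h => by simpa using h.length_lt
  | succ n ih =>
    obtain ⟨p, hp, hpl, hcov, hun⟩ := ih (by omega)
    have hpQ := hQ p hp (by omega)
    have hφp := φ.map_mem_dihedral ha hp hpQ
    have hφpl := hcov.length_eq_of_mem_dihedral hφp
    obtain ⟨q, hq, hql, hqp⟩ : ∃ q ∈ dihedral cs i j, cs.length q = n + 1 ∧ q ≠ φ.toFun p := by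
      obtain ⟨u, hu, v, hv, hul, hvl, huv⟩ := exists_ne_of_lt_length cs hx (by omega) hn
      by_cases h : u = φ.toFun p
      · exact ⟨v, hv, hvl, fun h' => huv (h.trans h'.symm)⟩
      · exact ⟨u, hu, hul, h⟩
    have hqQ := hQ q hq (by omega)
    refine ⟨q, hq, hql, (φ.cov q hqQ).resolve_left fun h => ?_, fun r hr hrl hrq => ?_⟩
    · have hφq := mem_dihedral_of_bruhatLE cs hq h.1
      have hφql := h.length_eq_of_mem_dihedral hq
      have := hun _ hφq (by omega) fun he => hqp (by rw [← he, φ.invol q hqQ])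
      rw [φ.invol q hqQ] at this
      exact lt_asymm this.length_lt h.length_lt
    · rcases eq_or_eq_of_length_eq cs hq hφp hr (by omega) (by omega) hqp with rfl | rfl
      · exact (hrq rfl).elim
      · rwa [φ.invol p hpQ]

open Classical in
/-- The extension of a partial special matching by one new pair `x ⋖ y`. -/
noncomputable def BSM.extend (x y : W) (hx : x ∉ φ.dom) (hy : y ∉ φ.dom) (hxy : bCov cs x y)
    (hlx : ∀ z, bruhatLE cs z x → z = x ∨ z ∈ φ.dom)
    (hly : ∀ z, bruhatLE cs z y → z = y ∨ z = x ∨ z ∈ φ.dom)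
    (hcoat : bCoat cs y =
      {x} ∪ {w | ∃ v, bCov cs v x ∧ bCov cs v (φ.toFun v) ∧ w = φ.toFun v}) : BSM cs where
  dom := {z | z = x ∨ z = y ∨ z ∈ φ.dom}
  toFun z := if z = x then y else if z = y then x else φ.toFun z
  ideal := by
    rintro u v (rfl | rfl | hv) huv
    · exact (hlx u huv).imp_right Or.inr
    · have := hly u huv
      tauto
    · exact Or.inr (Or.inr (φ.ideal hv huv))
  maps := by
    have hm := φ.maps
    grind
  invol := by
    have hm := φ.maps
    have hi := φ.invol
    grind
  cov := by
    have hc := φ.cov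
    grind
  coatom := by
    have heq : ∀ z ∈ φ.dom, (if z = x then y else if z = y then x else φ.toFun z) = φ.toFun z := by
      grind
    have hset : ∀ u, (∀ v, bCov cs v u → v ∈ φ.dom) →
        {w | ∃ v, bCov cs v u ∧
          bCov cs v (if v = x then y else if v = y then x else φ.toFun v) ∧
          w = if v = x then y else if v = y then x else φ.toFun v} =
        {w | ∃ v, bCov cs v u ∧ bCov cs v (φ.toFun v) ∧ w = φ.toFun v} := by
      intro u hu
      ext w
      refine exists_congr fun v => and_congr_right fun hv => ?_
      rw [heq v (hu v hv)]
    rintro u (rfl | rfl | hu) hcov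
    · rw [if_pos rfl, hset, hcoat]
      exact fun v hv => (hlx v hv.1).resolve_left hv.2.1
    · rw [if_neg hxy.2.1.symm, if_pos rfl] at hcov
      exact (lt_asymm hcov.length_lt hxy.length_lt).elim
    · rw [heq u hu] at hcov ⊢
      rw [hset u fun v hv => φ.ideal hu hv.1, φ.coatom u hu hcov]

lemma BSM.extend_extends {x y : W} (hx : x ∉ φ.dom) (hy : y ∉ φ.dom) (hxy : bCov cs x y)
    (hlx : ∀ z, bruhatLE cs z x → z = x ∨ z ∈ φ.dom)
    (hly : ∀ z, bruhatLE cs z y → z = y ∨ z = x ∨ z ∈ φ.dom)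
    (hcoat : bCoat cs y =
      {x} ∪ {w | ∃ v, bCov cs v x ∧ bCov cs v (φ.toFun v) ∧ w = φ.toFun v}) :
    BExtends (φ.extend x y hx hy hxy hlx hly hcoat) φ := by
  refine ⟨fun z hz => Or.inr (Or.inr hz), fun z hz => ?_⟩
  simp only [BSM.extend]
  rw [if_neg (by rintro rfl; exact hx hz), if_neg (by rintro rfl; exact hy hz)]

/-- The domain of a maximal partial special matching contains every dihedral standard parabolic
subgroup containing the partner of `1`. -/
theorem BMax.dihedral_subset {φ : BSM cs} (hmax : BMax φ) {i j : B} (h1 : (1 : W) ∈ φ.dom)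
    (ha : φ.toFun 1 ∈ dihedral cs i j) : dihedral cs i j ⊆ φ.dom := by
  by_contra hsub
  obtain ⟨x, ⟨hx, hxQ⟩, hmin⟩ : ∃ x, (x ∈ dihedral cs i j ∧ x ∉ φ.dom) ∧
      ∀ w, w ∈ dihedral cs i j ∧ w ∉ φ.dom → cs.length x ≤ cs.length w := by
    have hne : (dihedral cs i j \ φ.dom).Nonempty := Set.sdiff_nonempty.2 hsub
    exact ⟨_, Function.argminOn_mem cs.length _ hne, fun w hw => Function.argminOn_le cs.length _ hw⟩
  have hQ : ∀ w ∈ dihedral cs i j, cs.length w < cs.length x → w ∈ φ.dom := by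
    intro w hw hl
    by_contra hwQ
    exact hl.not_ge (hmin w ⟨hw, hwQ⟩)
  obtain ⟨n, hn⟩ : ∃ n, cs.length x = n + 1 := by
    refine Nat.exists_eq_succ_of_ne_zero fun h0 => hxQ ?_
    rwa [cs.length_eq_zero_iff.1 h0]
  obtain ⟨p, hp, hpl, hcov, hun⟩ := φ.exists_unique_matched_up h1 ha hx hQ (n := n) (by omega)
  have hpQ := hQ p hp (by omega)
  have hw := φ.map_mem_dihedral ha hp hpQ
  have hwQ := φ.maps p hpQ
  have hwl := hcov.length_eq_of_mem_dihedral hw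
  have hxw : x ≠ φ.toFun p := fun h => hxQ (h ▸ hwQ)
  obtain ⟨y, hy, hyl⟩ := exists_length_eq_succ cs hx hw (by omega) hxw
  have hxy := bCov_of_mem_dihedral cs hx hy hyl
  have hyQ : y ∉ φ.dom := fun h => hxQ (φ.ideal h hxy.1)
  have hlx : ∀ z, bruhatLE cs z x → z = x ∨ z ∈ φ.dom := fun z hz =>
    hz.eq_or_length_lt.imp_right (hQ z (mem_dihedral_of_bruhatLE cs hx hz))
  have hlevel : ∀ z ∈ dihedral cs i j, cs.length z = cs.length x → z = x ∨ z = φ.toFun p :=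
    fun z hz hzl => eq_or_eq_of_length_eq cs hx hw hz (by omega) hzl hxw
  have hly : ∀ z, bruhatLE cs z y → z = y ∨ z = x ∨ z ∈ φ.dom := by
    intro z hz
    refine hz.eq_or_length_lt.imp_right fun hl => ?_
    have hzD := mem_dihedral_of_bruhatLE cs hy hz
    rcases (show cs.length z < cs.length x ∨ cs.length z = cs.length x by omega) with h | h
    · exact Or.inr (hQ z hzD h)
    · exact (hlevel z hzD h).imp_right fun (he : z = φ.toFun p) => he ▸ hwQ
  have hcoat : bCoat cs y =
      {x} ∪ {w | ∃ v, bCov cs v x ∧ bCov cs v (φ.toFun v) ∧ w = φ.toFun v} := by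
    ext c
    constructor
    · intro hc
      have hcl := bCov.length_eq_of_mem_dihedral hc hy
      exact (hlevel c (mem_dihedral_of_bruhatLE cs hy hc.1) (by omega)).imp_right fun h =>
        ⟨p, bCov_of_mem_dihedral cs hp hx (by omega), hcov, h⟩
    · rintro (rfl | ⟨v, hvx, hv, rfl⟩)
      · exact hxy
      · have hvl := hvx.length_eq_of_mem_dihedral hx
        have hvp : v = p := by
          by_contra hne
          exact lt_asymm hv.length_lt
            (hun v (mem_dihedral_of_bruhatLE cs hx hvx.1) (by omega) hne).length_lt
        subst hvp
        exact bCov_of_mem_dihedral cs hw hy (by omega)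
  refine hxQ (hmax _ (φ.extend_extends hxQ hyQ hxy hlx hly hcoat) ▸ ?_)
  exact Or.inl rfl

end Matching

/-- for a maximal partial special matching `φ` with `a = φ(e) ∈ S`, each
principal dihedral subgroup `P_s = ⟨s,a⟩` is contained in the domain and stable
under `φ`. -/
theorem stmt4 {B : Type*} {W : Type*} [Group W] {M : CoxeterMatrix B}
    (cs : CoxeterSystem M W) (φ : BSM cs) (hmax : BMax φ)
    (h1 : (1 : W) ∈ φ.dom) (a : B) (ha : φ.toFun 1 = cs.simple a)
    (s : B) (hs : s ≠ a) :
    dihedral cs s a ⊆ φ.dom ∧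
      ∀ w ∈ dihedral cs s a, φ.toFun w ∈ dihedral cs s a := by
  have ha' : φ.toFun 1 ∈ dihedral cs s a := by
    rw [ha]
    exact Subgroup.subset_closure (by simp)
  have hsub := hmax.dihedral_subset h1 ha'
  exact ⟨hsub, fun w hw => φ.map_mem_dihedral ha' hw (hsub hw)⟩
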